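/- arXiv:1008.1744 — 2 statements merged into one kernel-verified Lean document; each statement's English description precedes it below -/
import Mathlib

section
/- Let r ≥ 1 and −∞ < a < b < ∞. For every R ≥ 0 and every α < 0 (including α = −∞), D^α_{U([a,b])}(R) = D^0_{U([a,b])}(R), where U([a,b]) is the uniform distribution on [a,b]. -/
open MeasureTheory Filter Set
open scoped ENNReal Topology Classical

noncomputable section

/-- A scalar quantizer: a Borel measurable map `ℝ → ℝ` with countable range. -/
def IsQuantizer (q : ℝ → ℝ) : Prop :=
  Measurable q ∧ (Set.range q).Countable

/-- The Rényi entropy of order `α ∈ [-∞,∞]` of the quantizer `q` with respect to `μ`. -/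
def renyiEntropy (α : EReal) (μ : Measure ℝ) (q : ℝ → ℝ) : EReal :=
  if α = ⊤ then
    - ENNReal.log (⨆ a : ℝ, μ (q ⁻¹' {a}))
  else if α = ⊥ then
    - ENNReal.log (⨅ a ∈ {a : ℝ | 0 < μ (q ⁻¹' {a})}, μ (q ⁻¹' {a}))
  else if α = 1 then
    ((∑' a : ℝ, ENNReal.ofReal (-((μ (q ⁻¹' {a})).toReal * Real.log (μ (q ⁻¹' {a})).toReal)) : ℝ≥0∞) : EReal)
  else
    (((1 - α.toReal)⁻¹ : ℝ) : EReal) *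
      ENNReal.log (∑' a : ℝ, if 0 < μ (q ⁻¹' {a}) then μ (q ⁻¹' {a}) ^ α.toReal else 0)

/-- The `r`-th power distortion of the quantizer `q` with respect to `μ`. -/
def distortion (r : ℝ) (μ : Measure ℝ) (q : ℝ → ℝ) : ℝ≥0∞ :=
  ∫⁻ x, ENNReal.ofReal (|x - q x| ^ r) ∂μ

/-- The optimal quantization error under Rényi entropy constraint `R` of order `α`. -/
def optErr (r : ℝ) (α : EReal) (μ : Measure ℝ) (R : ℝ) : ℝ≥0∞ :=
  ⨅ (q : ℝ → ℝ) (_ : IsQuantizer q ∧ renyiEntropy α μ q ≤ (R : EReal)), distortion r μ q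

/-- The (topological) support of a measure on `ℝ`. -/
def msupport (μ : Measure ℝ) : Set ℝ :=
  {x : ℝ | ∀ ε > 0, 0 < μ (Set.Ioo (x - ε) (x + ε))}

/-- The constant `C(r) = 1/((1+r)2^r)`. -/
def Cr (r : ℝ) : ℝ := 1 / ((1 + r) * 2 ^ r)

/-- `a₁ = (1-α+αr)/(1-α+r)`. -/
def a1 (α r : ℝ) : ℝ := (1 - α + α * r) / (1 - α + r)

/-- `a₂ = (1-α+r)/(1-α)`. -/
def a2 (α r : ℝ) : ℝ := (1 - α + r) / (1 - α)

/-- The class `Q^c`: quantizers with finitely many codecells, each an interval,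
with each codepoint in the closure of its codecell. -/
def Qc (q : ℝ → ℝ) : Prop :=
  Measurable q ∧ (Set.range q).Finite ∧
    ∀ a ∈ Set.range q, (q ⁻¹' {a}).OrdConnected ∧ a ∈ closure (q ⁻¹' {a})

/-- The compressor associated with a point density `g`. -/
def compressor (g : ℝ → ℝ) (x : ℝ) : ℝ := ∫ y in Set.Iic x, g y

/-- The generalized inverse of the compressor of `g`, extended to `[0,1]` by the
endpoints of the support of `g·λ`. -/
def geninv (g : ℝ → ℝ) (y : ℝ) : ℝ :=
  if y ≤ 0 then sInf (msupport (volume.withDensity fun x => ENNReal.ofReal (g x)))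
  else if 1 ≤ y then sSup (msupport (volume.withDensity fun x => ENNReal.ofReal (g x)))
  else sSup {x : ℝ | compressor g x ≤ y}

/-- The `N`-level uniform quantizer on `[0,1]`: each cell `((i-1)/N, i/N]`
(the first cell being `[0,1/N]`) is mapped to its midpoint `(2i-1)/(2N)`. -/
def uniformQ (N : ℕ) (x : ℝ) : ℝ :=
  ((2 * max 1 ⌈x * (N : ℝ)⌉ - 1 : ℤ) : ℝ) / (2 * (N : ℝ))

/-- The `N`-level companding quantizer with point density `g`. -/
def compand (g : ℝ → ℝ) (N : ℕ) (x : ℝ) : ℝ :=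
  geninv g (uniformQ N (compressor g x))

/-- The infinite-level uniform quantizer with step `Δ`, mapping `(iΔ,(i+1)Δ]` to `(i+1/2)Δ`. -/
def unifQ (Δ : ℝ) (x : ℝ) : ℝ := (((⌈x / Δ⌉ : ℤ) : ℝ) - 1 / 2) * Δ

/-- The quantizer obtained from `unifQ Δ` by keeping only codecells entirely inside `M`. -/
def unifQres (Δ : ℝ) (M : Set ℝ) (x : ℝ) : ℝ :=
  if unifQ Δ ⁻¹' {unifQ Δ x} ⊆ M then unifQ Δ x else 0

/-- The Rényi differential entropy of order `α ∈ ℝ` of `μ` with density `f`. -/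
def diffEntropyR (α : ℝ) (μ : Measure ℝ) (f : ℝ → ℝ) : ℝ :=
  if α = 1 then -∫ x, f x * Real.log (f x)
  else (1 - α)⁻¹ * Real.log (∫ x in msupport μ, f x ^ α)

/-- The Rényi relative entropy of order `α ∈ [-∞,∞)` between `μ = f·λ` and `ν = g·λ`. -/
def relEntropyR (α : EReal) (μ : Measure ℝ) (f g : ℝ → ℝ) : ℝ :=
  if α = ⊥ then
    Real.log (essInf (fun x => f x / g x)
      (volume.restrict (Set.Ioo (sInf (msupport μ)) (sSup (msupport μ)))))
  else if α = 1 then ∫ x in {x : ℝ | 0 < f x}, f x * Real.log (f x / g x)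
  else (α.toReal - 1)⁻¹ *
    Real.log (∫ x in {x : ℝ | 0 < f x}, f x ^ α.toReal * g x ^ (1 - α.toReal))

/-- The `r`-th absolute moment of Lebesgue measure on `[-1, 1)`. -/
def unitMoment (r : ℝ) : ℝ≥0∞ :=
  ∫⁻ y in Set.Ico (-1 : ℝ) 1, ENNReal.ofReal (|y| ^ r)

/-- The probability of every nonempty finite collection of codecells is at most one. -/
lemma sum_measure_fiber_le_one (μ : Measure ℝ) [IsProbabilityMeasure μ] {q : ℝ → ℝ}
    (hq : Measurable q) (s : Finset ℝ) : ∑ c ∈ s, μ (q ⁻¹' {c}) ≤ 1 := by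
  rw [sum_measure_preimage_singleton s fun c _ => hq (measurableSet_singleton c)]
  exact prob_le_one

/-- For nonpositive finite orders, an entropy bound is a bound on the power sum. -/
lemma renyiEntropy_le_iff {α : EReal} (hα : α ≤ 0) (hbot : α ≠ ⊥) (μ : Measure ℝ) (q : ℝ → ℝ)
    (R : ℝ) :
    renyiEntropy α μ q ≤ (R : EReal) ↔
      (∑' c : ℝ, if 0 < μ (q ⁻¹' {c}) then μ (q ⁻¹' {c}) ^ α.toReal else 0) ≤
        ENNReal.ofReal (Real.exp R) ^ (1 - α.toReal) := by
  have htop : α ≠ ⊤ := fun h => by simp [h] at hα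
  have hone : α ≠ 1 := fun h => by
    rw [h] at hα
    exact absurd hα (not_le.mpr zero_lt_one)
  have ha : α.toReal ≤ 0 := by
    lift α to ℝ using ⟨htop, hbot⟩
    exact_mod_cast hα
  have hR : (R : EReal) = ENNReal.log (ENNReal.ofReal (Real.exp R)) := by
    rw [ENNReal.log_ofReal_of_pos (Real.exp_pos R), Real.log_exp]
  rw [renyiEntropy, if_neg htop, if_neg hbot, if_neg hone, ← ENNReal.log_rpow, hR,
    ENNReal.log_le_log_iff, ENNReal.rpow_inv_le_iff (by linarith)]

/-- Power sums of nonpositive order over `n` cells of total mass at most one are at least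
`n ^ (1 - α)`. -/
lemma card_rpow_le_sum_rpow {ι : Type*} (s : Finset ι) (p : ι → ℝ) (hp : ∀ i ∈ s, 0 < p i)
    (hsum : ∑ i ∈ s, p i ≤ 1) {α : ℝ} (hα : α ≤ 0) :
    (s.card : ℝ) ^ (1 - α) ≤ ∑ i ∈ s, p i ^ α := by
  rcases s.eq_empty_or_nonempty with rfl | hs
  · simp [Real.zero_rpow (by linarith : 1 - α ≠ 0)]
  have hn : (0 : ℝ) < s.card := by exact_mod_cast hs.card_pos
  have key : ∀ i ∈ s, 1 + α * (s.card * p i - 1) ≤ (s.card : ℝ) ^ α * p i ^ α := by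
    intro i hi
    have hu : 0 < s.card * p i := mul_pos hn (hp i hi)
    rw [← Real.mul_rpow hn.le (hp i hi).le, Real.rpow_def_of_pos hu]
    have h1 := Real.log_le_sub_one_of_pos hu
    have h2 := Real.add_one_le_exp (Real.log (s.card * p i) * α)
    nlinarith
  have hle := Finset.sum_le_sum key
  rw [← Finset.mul_sum, Finset.sum_add_distrib, ← Finset.mul_sum, Finset.sum_sub_distrib,
    ← Finset.mul_sum] at hle
  simp only [Finset.sum_const, nsmul_eq_mul, mul_one] at hle
  have hcard : (s.card : ℝ) ≤ (s.card : ℝ) ^ α * ∑ i ∈ s, p i ^ α := by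
    have : 0 ≤ -α * (s.card * (1 - ∑ i ∈ s, p i)) :=
      mul_nonneg (by linarith) (mul_nonneg hn.le (by linarith))
    nlinarith
  rw [Real.rpow_sub hn, Real.rpow_one, div_le_iff₀ (Real.rpow_pos_of_pos hn α)]
  linarith

/-- An entropy bound of nonpositive order bounds the number of codecells of positive mass. -/
lemma card_le_of_renyiEntropy_le {α : EReal} (hα : α ≤ 0) (μ : Measure ℝ)
    [IsProbabilityMeasure μ] {q : ℝ → ℝ} (hq : Measurable q) {R : ℝ}
    (h : renyiEntropy α μ q ≤ (R : EReal)) (s : Finset ℝ)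
    (hs : ∀ c ∈ s, 0 < μ (q ⁻¹' {c})) :
    (s.card : ℝ≥0∞) ≤ ENNReal.ofReal (Real.exp R) := by
  have hsum := sum_measure_fiber_le_one μ hq s
  have hE0 : ENNReal.ofReal (Real.exp R) ≠ 0 := by simp [Real.exp_pos]
  by_cases hbot : α = ⊥
  · subst hbot
    rw [renyiEntropy, if_neg bot_ne_top, if_pos rfl, ← ENNReal.log_inv] at h
    have hR : (R : EReal) = ENNReal.log (ENNReal.ofReal (Real.exp R)) := by
      rw [ENNReal.log_ofReal_of_pos (Real.exp_pos R), Real.log_exp]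
    rw [hR, ENNReal.log_le_log_iff, ENNReal.inv_le_iff_inv_le] at h
    have hc : ∀ c ∈ s, (ENNReal.ofReal (Real.exp R))⁻¹ ≤ μ (q ⁻¹' {c}) :=
      fun c hc => h.trans (iInf₂_le c (hs c hc))
    have := (Finset.sum_le_sum hc).trans hsum
    rw [Finset.sum_const, nsmul_eq_mul, ← div_eq_mul_inv] at this
    simpa using (ENNReal.div_le_iff hE0 ENNReal.ofReal_ne_top).mp this
  · have ha : α.toReal ≤ 0 := by
      lift α to ℝ using ⟨fun h => by simp [h] at hα, hbot⟩
      exact_mod_cast hα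
    rw [renyiEntropy_le_iff hα hbot] at h
    have hS := (ENNReal.sum_le_tsum s).trans h
    rw [Finset.sum_congr rfl fun c hc => if_pos (hs c hc)] at hS
    have hpos : ∀ c ∈ s, 0 < μ.real (q ⁻¹' {c}) :=
      fun c hc => ENNReal.toReal_pos (hs c hc).ne' (measure_ne_top _ _)
    have hsum' : ∑ c ∈ s, μ.real (q ⁻¹' {c}) ≤ 1 := by
      rw [← ENNReal.ofReal_le_ofReal_iff zero_le_one,
        ENNReal.ofReal_sum_of_nonneg fun _ _ => measureReal_nonneg]
      simpa using hsum
    have hcard := ENNReal.ofReal_le_ofReal (card_rpow_le_sum_rpow s _ hpos hsum' ha)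
    rw [ENNReal.ofReal_sum_of_nonneg fun c hc => (Real.rpow_pos_of_pos (hpos c hc) _).le,
      ← ENNReal.ofReal_rpow_of_nonneg (Nat.cast_nonneg _) (by linarith),
      ENNReal.ofReal_natCast] at hcard
    rw [Finset.sum_congr rfl fun c hc => by
      rw [← ENNReal.ofReal_rpow_of_pos (hpos c hc), ofReal_measureReal]] at hcard
    exact (ENNReal.rpow_le_rpow_iff (by linarith)).mp (hcard.trans hS)

/-- A quantizer all of whose nonnull codecells have mass `p` has entropy at most `-log p`. -/
lemma renyiEntropy_le_of_fiber_eq {α : EReal} (hα : α ≤ 0) (μ : Measure ℝ)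
    [IsProbabilityMeasure μ] {q : ℝ → ℝ} (hq : Measurable q) {R : ℝ} {p : ℝ≥0∞}
    (hp0 : p ≠ 0) (hp1 : p ≠ ⊤) (hpR : p⁻¹ ≤ ENNReal.ofReal (Real.exp R))
    (h : ∀ c, 0 < μ (q ⁻¹' {c}) → μ (q ⁻¹' {c}) = p) :
    renyiEntropy α μ q ≤ (R : EReal) := by
  by_cases hbot : α = ⊥
  · subst hbot
    rw [renyiEntropy, if_neg bot_ne_top, if_pos rfl, ← ENNReal.log_inv]
    have hR : (R : EReal) = ENNReal.log (ENNReal.ofReal (Real.exp R)) := by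
      rw [ENNReal.log_ofReal_of_pos (Real.exp_pos R), Real.log_exp]
    rw [hR, ENNReal.log_le_log_iff]
    refine le_trans (ENNReal.inv_le_inv.mpr ?_) hpR
    exact le_iInf₂ fun c hc => (h c hc).ge
  · have ha : α.toReal ≤ 0 := by
      lift α to ℝ using ⟨fun h => by simp [h] at hα, hbot⟩
      exact_mod_cast hα
    rw [renyiEntropy_le_iff hα hbot]
    refine le_trans ?_ (ENNReal.rpow_le_rpow hpR (by linarith))
    have hterm : ∀ c, (if 0 < μ (q ⁻¹' {c}) then μ (q ⁻¹' {c}) ^ α.toReal else 0) =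
        p⁻¹ ^ (1 - α.toReal) * μ (q ⁻¹' {c}) := by
      intro c
      split_ifs with hc
      · rw [h c hc, ENNReal.inv_rpow, ← ENNReal.rpow_neg]
        conv_rhs => rw [← ENNReal.rpow_one p, ← ENNReal.rpow_mul, one_mul,
          ← ENNReal.rpow_add _ _ hp0 hp1]
        congr 1
        ring
      · rw [nonpos_iff_eq_zero.mp (not_lt.mp hc), mul_zero]
    simp_rw [hterm]
    rw [ENNReal.tsum_mul_left]
    refine mul_le_of_le_one_right' ?_
    rw [ENNReal.tsum_eq_iSup_sum]
    exact iSup_le (sum_measure_fiber_le_one μ hq)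

/-- The `r`-th absolute central moment of an interval of half-length `t`. -/
lemma lintegral_Ico_abs_sub_rpow (r c : ℝ) {t : ℝ} (ht : 0 < t) (hr : 0 ≤ r) :
    ∫⁻ x in Set.Ico (c - t) (c + t), ENNReal.ofReal (|x - c| ^ r) =
      ENNReal.ofReal t ^ (r + 1) * unitMoment r := by
  have himg : (fun y => t * y + c) '' Set.Ico (-1 : ℝ) 1 = Set.Ico (c - t) (c + t) := by
    rw [image_affine_Ico ht]
    congr 1 <;> ring
  have hderiv : ∀ y ∈ Set.Ico (-1 : ℝ) 1,
      HasDerivWithinAt (fun y => t * y + c) t (Set.Ico (-1 : ℝ) 1) y := fun y _ => by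
    simpa using (((hasDerivAt_id y).const_mul t).add_const c).hasDerivWithinAt
  have hinj : Set.InjOn (fun y => t * y + c) (Set.Ico (-1 : ℝ) 1) := fun y _ z _ hyz =>
    mul_left_cancel₀ ht.ne' (add_right_cancel hyz)
  rw [← himg, lintegral_image_eq_lintegral_abs_deriv_mul measurableSet_Ico hderiv hinj,
    unitMoment, ← lintegral_const_mul' _ _
      (ENNReal.rpow_ne_top_of_nonneg (by linarith) ENNReal.ofReal_ne_top)]
  refine lintegral_congr fun y => ?_
  rw [add_sub_cancel_right, abs_mul, abs_of_pos ht, Real.mul_rpow ht.le (abs_nonneg y),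
    ENNReal.ofReal_mul (Real.rpow_nonneg ht.le r), ← ENNReal.ofReal_rpow_of_pos ht,
    ENNReal.rpow_add _ _ (by simpa using ht) ENNReal.ofReal_ne_top, ENNReal.rpow_one]
  ring

/-- Among sets of given measure, the centred interval minimises the `r`-th moment about `c`. -/
lemma rpow_mul_unitMoment_le_lintegral {r : ℝ} (hr : 0 ≤ r) (c : ℝ) {A : Set ℝ}
    (hA : MeasurableSet A) (hfin : volume A ≠ ⊤) :
    (volume A / 2) ^ (r + 1) * unitMoment r ≤
      ∫⁻ x in A, ENNReal.ofReal (|x - c| ^ r) := by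
  rcases eq_or_ne (volume A) 0 with h0 | h0
  · simp [h0, ENNReal.zero_rpow_of_pos (by linarith : 0 < r + 1)]
  set t := (volume A).toReal / 2 with ht_def
  have ht : 0 < t := half_pos (ENNReal.toReal_pos h0 hfin)
  have htA : volume A / 2 = ENNReal.ofReal t := by
    rw [ht_def, ENNReal.ofReal_div_of_pos two_pos, ENNReal.ofReal_toReal hfin]
    simp
  set B := Set.Ico (c - t) (c + t) with hB_def
  have hB : MeasurableSet B := measurableSet_Ico
  have hvol : volume A = volume B := by
    rw [hB_def, Real.volume_Ico, ← ENNReal.ofReal_toReal hfin]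
    congr 1
    ring
  have hdiff : volume (A \ B) = volume (B \ A) :=
    measure_sdiff_symm hA.nullMeasurableSet hB.nullMeasurableSet hvol
      (ne_top_of_le_ne_top hfin (measure_mono Set.inter_subset_left))
  rw [htA, ← lintegral_Ico_abs_sub_rpow r c ht hr,
    ← lintegral_inter_add_sdiff _ A hB, ← lintegral_inter_add_sdiff _ B hA, Set.inter_comm B A]
  refine add_le_add le_rfl ?_
  calc ∫⁻ x in B \ A, ENNReal.ofReal (|x - c| ^ r)
      ≤ ∫⁻ x in B \ A, ENNReal.ofReal (t ^ r) := by
        refine setLIntegral_mono' (hB.diff hA) fun x hx => ENNReal.ofReal_le_ofReal ?_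
        refine Real.rpow_le_rpow (abs_nonneg _) ?_ hr
        have := hx.1
        rw [hB_def, Set.mem_Ico] at this
        rw [abs_le]
        constructor <;> linarith
    _ = ∫⁻ x in A \ B, ENNReal.ofReal (t ^ r) := by
        rw [setLIntegral_const, setLIntegral_const, hdiff]
    _ ≤ ∫⁻ x in A \ B, ENNReal.ofReal (|x - c| ^ r) := by
        refine setLIntegral_mono' (hA.diff hB) fun x hx => ENNReal.ofReal_le_ofReal ?_
        refine Real.rpow_le_rpow ht.le ?_ hr
        by_contra hlt
        rw [not_le, abs_lt] at hlt
        exact hx.2 ⟨by linarith [hlt.1], by linarith [hlt.2]⟩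

/-- Power-mean inequality: at most `N` summands of total `x` have `p`-power sum at least that of
`N` equal summands. -/
lemma natCast_mul_div_rpow_le_sum {ι : Type*} (s : Finset ι) (y : ι → ℝ≥0∞) {N : ℕ}
    (hN : 0 < N) (hs : s.card ≤ N) {r : ℝ} (hr : 0 ≤ r) :
    N * ((∑ i ∈ s, y i) / N) ^ (r + 1) ≤ ∑ i ∈ s, y i ^ (r + 1) := by
  have hN0 : (N : ℝ≥0∞) ≠ 0 := by exact_mod_cast hN.ne'
  have hNt : (N : ℝ≥0∞) ≠ ⊤ := ENNReal.natCast_ne_top N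
  have h := ENNReal.rpow_sum_le_const_mul_sum_rpow s y (p := r + 1) (by linarith)
  rw [add_sub_cancel_right] at h
  rw [ENNReal.div_rpow_of_nonneg _ _ (by linarith : 0 ≤ r + 1), ← mul_div_assoc,
    ENNReal.rpow_add _ _ hN0 hNt, ENNReal.rpow_one, mul_comm ((N : ℝ≥0∞) ^ r),
    ENNReal.mul_div_mul_left _ _ hN0 hNt]
  refine ENNReal.div_le_of_le_mul' (h.trans ?_)
  gcongr

/-- Lower bound on the unnormalised distortion over `[a, b]` of a quantizer with at most `N`
codecells of positive measure. -/
lemma le_setLIntegral_of_card_le {r : ℝ} (hr : 0 ≤ r) (a b : ℝ) {q : ℝ → ℝ}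
    (hq : IsQuantizer q) {N : ℕ} (hN : 0 < N) (S : Finset ℝ)
    (hS : ∀ c, 0 < volume (q ⁻¹' {c} ∩ Set.Icc a b) → c ∈ S) (hcard : S.card ≤ N) :
    N * ((volume (Set.Icc a b) / 2 / N) ^ (r + 1) * unitMoment r) ≤
      ∫⁻ x in Set.Icc a b, ENNReal.ofReal (|x - q x| ^ r) := by
  have hmeas : ∀ c, MeasurableSet (q ⁻¹' {c} ∩ Set.Icc a b) := fun c =>
    (hq.1 (measurableSet_singleton c)).inter measurableSet_Icc
  have hdisj : Set.PairwiseDisjoint (↑S) fun c => q ⁻¹' {c} ∩ Set.Icc a b :=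
    (pairwiseDisjoint_fiber q _).mono fun c => Set.inter_subset_left
  have hcover : volume (Set.Icc a b) ≤ ∑ c ∈ S, volume (q ⁻¹' {c} ∩ Set.Icc a b) := by
    rw [← measure_biUnion_finset hdisj fun c _ => hmeas c]
    have hnull : volume (⋃ c ∈ Set.range q \ S, q ⁻¹' {c} ∩ Set.Icc a b) = 0 :=
      (measure_biUnion_null_iff (hq.2.mono Set.sdiff_subset)).mpr fun c hc => by
        by_contra h
        exact hc.2 (hS c (pos_iff_ne_zero.mpr h))
    calc volume (Set.Icc a b)
        ≤ volume ((⋃ c ∈ S, q ⁻¹' {c} ∩ Set.Icc a b) ∪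
            ⋃ c ∈ Set.range q \ S, q ⁻¹' {c} ∩ Set.Icc a b) := by
          refine measure_mono fun x hx => ?_
          by_cases h : q x ∈ S
          · exact Or.inl (Set.mem_biUnion h ⟨rfl, hx⟩)
          · exact Or.inr (Set.mem_biUnion (⟨⟨x, rfl⟩, h⟩ : q x ∈ Set.range q \ S) ⟨rfl, hx⟩)
      _ ≤ _ := (measure_union_le _ _).trans (by rw [hnull, add_zero])
  calc N * ((volume (Set.Icc a b) / 2 / N) ^ (r + 1) * unitMoment r)
      ≤ N * (((∑ c ∈ S, volume (q ⁻¹' {c} ∩ Set.Icc a b) / 2) / N) ^ (r + 1) *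
          unitMoment r) := by
        simp_rw [div_eq_mul_inv]
        rw [← Finset.sum_mul]
        gcongr
    _ ≤ (∑ c ∈ S, (volume (q ⁻¹' {c} ∩ Set.Icc a b) / 2) ^ (r + 1)) * unitMoment r := by
        rw [← mul_assoc]
        gcongr
        exact natCast_mul_div_rpow_le_sum S _ hN hcard hr
    _ ≤ ∑ c ∈ S, ∫⁻ x in q ⁻¹' {c} ∩ Set.Icc a b, ENNReal.ofReal (|x - q x| ^ r) := by
        rw [Finset.sum_mul]
        refine Finset.sum_le_sum fun c _ => ?_
        rw [setLIntegral_congr_fun (hmeas c) (g := fun x => ENNReal.ofReal (|x - c| ^ r))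
          fun x hx => by simp only [show q x = c from hx.1]]
        exact rpow_mul_unitMoment_le_lintegral hr c (hmeas c)
          (ne_top_of_le_ne_top measure_Icc_lt_top.ne (measure_mono Set.inter_subset_right))
    _ = ∫⁻ x in ⋃ c ∈ S, q ⁻¹' {c} ∩ Set.Icc a b, ENNReal.ofReal (|x - q x| ^ r) :=
        (lintegral_biUnion_finset hdisj (fun c _ => hmeas c) _).symm
    _ ≤ _ := lintegral_mono_set (Set.iUnion₂_subset fun c _ => Set.inter_subset_right)

/-- The uniform quantizer with cells `[a + k h, a + (k + 1) h)` and midpoint codepoints. -/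
def midpointQ (a h x : ℝ) : ℝ := a + (⌊(x - a) / h⌋ + 1 / 2) * h

lemma isQuantizer_midpointQ (a h : ℝ) : IsQuantizer (midpointQ a h) := by
  refine ⟨?_, ?_⟩
  · unfold midpointQ
    have : Measurable fun x : ℝ => ((⌊(x - a) / h⌋ : ℤ) : ℝ) :=
      (measurable_from_top (f := fun z : ℤ => (z : ℝ))).comp
        (Int.measurable_floor.comp ((measurable_id.sub_const a).div_const h))
    exact ((this.add_const _).mul_const _).const_add _
  · refine (Set.countable_range fun k : ℤ => a + ((k : ℝ) + 1 / 2) * h).mono ?_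
    rintro _ ⟨x, rfl⟩
    exact ⟨⌊(x - a) / h⌋, rfl⟩

lemma floor_sub_div_eq_iff (a : ℝ) {h : ℝ} (hh : 0 < h) (x : ℝ) (k : ℤ) :
    ⌊(x - a) / h⌋ = k ↔ x ∈ Set.Ico (a + k * h) (a + (k + 1) * h) := by
  rw [Int.floor_eq_iff, le_div_iff₀ hh, div_lt_iff₀ hh, Set.mem_Ico]
  constructor <;> rintro ⟨h1, h2⟩ <;> constructor <;> linarith

lemma midpointQ_preimage (a : ℝ) {h : ℝ} (hh : 0 < h) (y : ℝ) :
    midpointQ a h ⁻¹' {midpointQ a h y} =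
      Set.Ico (a + ⌊(y - a) / h⌋ * h) (a + (⌊(y - a) / h⌋ + 1) * h) := by
  ext x
  rw [← floor_sub_div_eq_iff a hh, Set.mem_preimage, Set.mem_singleton_iff, midpointQ, midpointQ,
    add_right_inj, mul_left_inj' hh.ne', add_left_inj, Int.cast_inj]

/-- Each codecell of the midpoint quantizer meets `[a, a + N h]` in a null set or a full cell. -/
lemma volume_midpointQ_fiber (a : ℝ) {h : ℝ} (hh : 0 < h) (N : ℕ) (c : ℝ)
    (hc : 0 < volume (midpointQ a h ⁻¹' {c} ∩ Set.Icc a (a + N * h))) :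
    volume (midpointQ a h ⁻¹' {c} ∩ Set.Icc a (a + N * h)) = ENNReal.ofReal h := by
  obtain ⟨y, rfl⟩ : c ∈ Set.range (midpointQ a h) := by
    by_contra hcr
    rw [Set.preimage_singleton_eq_empty.mpr hcr] at hc
    simp at hc
  rw [midpointQ_preimage a hh] at hc ⊢
  set k := ⌊(y - a) / h⌋
  have hk0 : 0 ≤ k := by
    by_contra hk
    have hk1 : (k : ℝ) + 1 ≤ 0 := by exact_mod_cast (by omega : k + 1 ≤ 0)
    refine hc.ne' (measure_mono_null (t := ∅) (fun x hx => ?_) measure_empty)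
    have := hx.1.2
    have := hx.2.1
    nlinarith
  have hkN : k + 1 ≤ N := by
    by_contra hk
    have hk1 : (N : ℝ) ≤ k := by exact_mod_cast (by omega : (N : ℤ) ≤ k)
    refine hc.ne' (measure_mono_null (t := {a + N * h}) (fun x hx => ?_)
      (measure_singleton _))
    have := hx.1.1
    have := hx.2.2
    rw [Set.mem_singleton_iff]
    nlinarith
  have hk0' : (0 : ℝ) ≤ k := by exact_mod_cast hk0
  have hkN' : (k : ℝ) + 1 ≤ N := by exact_mod_cast hkN
  rw [Set.inter_eq_left.mpr, Real.volume_Ico]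
  · congr 1
    ring
  · rintro x ⟨h1, h2⟩
    constructor <;> nlinarith

/-- Upper bound on the unnormalised distortion of the midpoint quantizer over `N` cells. -/
lemma setLIntegral_midpointQ_le {r : ℝ} (hr : 0 ≤ r) (a : ℝ) {h : ℝ} (hh : 0 < h) (N : ℕ) :
    ∫⁻ x in Set.Icc a (a + N * h), ENNReal.ofReal (|x - midpointQ a h x| ^ r) ≤
      N * (ENNReal.ofReal (h / 2) ^ (r + 1) * unitMoment r) := by
  have hsub : Set.Ico a (a + N * h) ⊆
      ⋃ k : Fin N, Set.Ico (a + ((k : ℕ) : ℤ) * h) (a + (((k : ℕ) : ℤ) + 1) * h) := by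
    rintro x ⟨h1, h2⟩
    have h0 : 0 ≤ (x - a) / h := div_nonneg (by linarith) hh.le
    have hlt : (x - a) / h < N := by
      rw [div_lt_iff₀ hh]
      linarith
    refine Set.mem_iUnion.mpr ⟨⟨⌊(x - a) / h⌋₊, (Nat.floor_lt h0).mpr hlt⟩, ?_⟩
    rw [← floor_sub_div_eq_iff a hh]
    exact (Int.natCast_floor_eq_floor h0).symm
  rw [← setLIntegral_congr Ico_ae_eq_Icc]
  refine (lintegral_mono_set hsub).trans ((lintegral_iUnion_le _ _).trans ?_)
  rw [tsum_fintype]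
  refine (Finset.sum_le_card_nsmul _ _ (ENNReal.ofReal (h / 2) ^ (r + 1) * unitMoment r)
    fun k _ => ?_).trans (by simp)
  set c := a + ((((k : ℕ) : ℤ) : ℝ) + 1 / 2) * h
  rw [← lintegral_Ico_abs_sub_rpow r c (half_pos hh) hr,
    show c - h / 2 = a + ((k : ℕ) : ℤ) * h by ring,
    show c + h / 2 = a + (((k : ℕ) : ℤ) + 1) * h by ring]
  refine (setLIntegral_congr_fun measurableSet_Ico fun x hx => ?_).le
  rw [← floor_sub_div_eq_iff a hh] at hx
  simp only [midpointQ, hx, c]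

/-- The optimal error of the uniform distribution at every nonpositive order is the distortion
of `N = ⌊exp R⌋` equal cells. -/
lemma optErr_uniform_eq {r : ℝ} (hr : 0 ≤ r) {a b : ℝ} (hab : a < b) {R : ℝ} (hR : 0 ≤ R)
    {α : EReal} (hα : α ≤ 0) :
    optErr r α ((volume (Set.Icc a b))⁻¹ • volume.restrict (Set.Icc a b)) R =
      (volume (Set.Icc a b))⁻¹ * (⌊Real.exp R⌋₊ *
        ((volume (Set.Icc a b) / 2 / ⌊Real.exp R⌋₊) ^ (r + 1) * unitMoment r)) := by
  set N := ⌊Real.exp R⌋₊ with hN_def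
  have hN : 0 < N := Nat.floor_pos.mpr (Real.one_le_exp hR)
  have hN' : (0 : ℝ) < N := by exact_mod_cast hN
  have hL : volume (Set.Icc a b) = ENNReal.ofReal (b - a) := Real.volume_Icc
  have hL0 : volume (Set.Icc a b) ≠ 0 := by simp [hL, hab]
  have hLt : volume (Set.Icc a b) ≠ ⊤ := measure_Icc_lt_top.ne
  set μ := (volume (Set.Icc a b))⁻¹ • volume.restrict (Set.Icc a b) with hμ
  have hprob : IsProbabilityMeasure μ :=
    ⟨by rw [hμ, Measure.smul_apply, Measure.restrict_apply_univ, smul_eq_mul,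
      ENNReal.inv_mul_cancel hL0 hLt]⟩
  have hfiber : ∀ {q : ℝ → ℝ}, Measurable q → ∀ c,
      μ (q ⁻¹' {c}) = (volume (Set.Icc a b))⁻¹ * volume (q ⁻¹' {c} ∩ Set.Icc a b) :=
    fun hq c => by
      rw [hμ, Measure.smul_apply, smul_eq_mul,
        Measure.restrict_apply (hq (measurableSet_singleton c))]
  have hpos : ∀ {q : ℝ → ℝ}, Measurable q → ∀ c,
      0 < μ (q ⁻¹' {c}) ↔ 0 < volume (q ⁻¹' {c} ∩ Set.Icc a b) := fun hq c => by
    rw [hfiber hq, ENNReal.mul_pos_iff]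
    simp
  have hdist : ∀ q, distortion r μ q =
      (volume (Set.Icc a b))⁻¹ * ∫⁻ x in Set.Icc a b, ENNReal.ofReal (|x - q x| ^ r) :=
    fun q => by rw [distortion, hμ, lintegral_smul_measure, smul_eq_mul]
  apply le_antisymm
  · set h := (b - a) / N with hh_def
    have hh : 0 < h := div_pos (by linarith) hN'
    have hb : b = a + N * h := by
      rw [hh_def]
      field_simp
      ring
    have hq := isQuantizer_midpointQ a h
    have hent : renyiEntropy α μ (midpointQ a h) ≤ (R : EReal) := by
      refine renyiEntropy_le_of_fiber_eq hα μ hq.1 (p := (N : ℝ≥0∞)⁻¹) (by simp)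
        (by simpa using hN.ne') ?_ fun c hc => ?_
      · rw [inv_inv, ← ENNReal.ofReal_natCast]
        exact ENNReal.ofReal_le_ofReal (Nat.floor_le (Real.exp_pos R).le)
      · rw [hpos hq.1] at hc
        rw [hfiber hq.1, hL]
        rw [hb] at hc ⊢
        rw [volume_midpointQ_fiber a hh N c hc, add_sub_cancel_left,
          ← ENNReal.ofReal_inv_of_pos (mul_pos hN' hh),
          ← ENNReal.ofReal_mul (inv_pos.mpr (mul_pos hN' hh)).le,
          ← ENNReal.ofReal_natCast, ← ENNReal.ofReal_inv_of_pos hN']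
        congr 1
        field_simp
    refine (iInf₂_le (midpointQ a h) ⟨hq, hent⟩).trans ?_
    rw [hdist]
    gcongr
    have hhalf : volume (Set.Icc a b) / 2 / N = ENNReal.ofReal (h / 2) := by
      rw [hL, hh_def, div_right_comm, ENNReal.ofReal_div_of_pos hN',
        ENNReal.ofReal_div_of_pos two_pos, ENNReal.ofReal_natCast, ENNReal.ofReal_ofNat]
    rw [hhalf, hb]
    exact setLIntegral_midpointQ_le hr a hh N
  · refine le_iInf₂ fun q hq => ?_
    rw [hdist]
    gcongr
    have hcard : ∀ s : Finset ℝ, ↑s ⊆ {c | 0 < μ (q ⁻¹' {c})} → s.card ≤ N := fun s hs => by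
      have := card_le_of_renyiEntropy_le hα μ hq.1.1 hq.2 s hs
      rw [← ENNReal.ofReal_natCast, ENNReal.ofReal_le_ofReal_iff (Real.exp_pos R).le] at this
      exact Nat.le_floor this
    have hfin : {c | 0 < μ (q ⁻¹' {c})}.Finite := by
      by_contra hinf
      obtain ⟨s, hs, hsN⟩ := Set.Infinite.exists_subset_card_eq hinf (N + 1)
      have := hcard s hs
      omega
    refine le_setLIntegral_of_card_le hr a b hq.1 hN hfin.toFinset (fun c hc => ?_)
      (hcard _ (by simp))
    simpa [hpos hq.1.1 c] using hc

/-- for uniform distributions the optimal error for any negative order equals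
the fixed-rate (`α = 0`) optimal error. -/
theorem statement18
    (r : ℝ) (hr : 1 ≤ r) (a b : ℝ) (hab : a < b)
    (R : ℝ) (hR : 0 ≤ R) (α : EReal) (hα : α < 0) :
    optErr r α ((volume (Set.Icc a b))⁻¹ • volume.restrict (Set.Icc a b)) R =
      optErr r (0 : EReal) ((volume (Set.Icc a b))⁻¹ • volume.restrict (Set.Icc a b)) R := by
  rw [optErr_uniform_eq (by linarith) hab hR hα.le, optErr_uniform_eq (by linarith) hab hR le_rfl]

end
end

section
/- Let r > 1 and let U([0,1]) be the uniform distribution on the unit interval. Then for every α ∈ [−∞, r+1), lim_{R→∞} e^{rR}·D^α_{U([0,1])}(R) = C(r). -/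
open MeasureTheory Filter Set
open scoped ENNReal Topology Classical

noncomputable section

lemma exists_eq_ofReal_exp {p : ℝ≥0∞} (h0 : p ≠ 0) (h1 : p ≠ ⊤) :
    ∃ s : ℝ, p = ENNReal.ofReal (Real.exp s) :=
  ⟨Real.log p.toReal, by
    rw [Real.exp_log (ENNReal.toReal_pos h0 h1), ENNReal.ofReal_toReal h1]⟩

lemma ofReal_exp_rpow (s y : ℝ) :
    ENNReal.ofReal (Real.exp s) ^ y = ENNReal.ofReal (Real.exp (s * y)) := by
  rw [ENNReal.ofReal_rpow_of_pos (Real.exp_pos s), ← Real.exp_mul]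

lemma log_le_coe_iff {x : ℝ≥0∞} {y : ℝ} :
    ENNReal.log x ≤ (y : EReal) ↔ x ≤ ENNReal.ofReal (Real.exp y) := by
  rw [← ENNReal.log_le_log_iff, ENNReal.log_ofReal_of_pos (Real.exp_pos y), Real.log_exp]

lemma coe_le_log_iff {x : ℝ≥0∞} {y : ℝ} :
    (y : EReal) ≤ ENNReal.log x ↔ ENNReal.ofReal (Real.exp y) ≤ x := by
  rw [← ENNReal.log_le_log_iff, ENNReal.log_ofReal_of_pos (Real.exp_pos y), Real.log_exp]

lemma ne_top_of_tsum_eq_one {ι : Type*} {P : ι → ℝ≥0∞} (hP : ∑' a, P a = 1) (a : ι) :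
    P a ≠ ⊤ :=
  ne_top_of_le_ne_top ENNReal.one_ne_top ((ENNReal.le_tsum a).trans hP.le)

lemma one_le_moment_of_order_lt_one {ι : Type*} {P : ι → ℝ≥0∞} (hP : ∑' a, P a = 1)
    {r β R : ℝ} (hr : 0 < r) (hβ : 0 < β)
    (h : ∑' a, (if 0 < P a then P a ^ (1 - β) else 0) ≤ ENNReal.ofReal (Real.exp (β * R))) :
    1 ≤ ENNReal.ofReal (Real.exp (r * R)) * ∑' a, P a ^ (r + 1) := by
  have key : ∀ a, ENNReal.ofReal (β + r) * P a ≤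
      ENNReal.ofReal β * (ENNReal.ofReal (Real.exp (r * R)) * P a ^ (r + 1)) +
      ENNReal.ofReal r * (ENNReal.ofReal (Real.exp (-(β * R))) *
        (if 0 < P a then P a ^ (1 - β) else 0)) := by
    intro a
    rcases eq_or_ne (P a) 0 with h0 | h0
    · simp [h0]
    obtain ⟨s, hs⟩ := exists_eq_ofReal_exp h0 (ne_top_of_tsum_eq_one hP a)
    rw [if_pos (pos_iff_ne_zero.2 h0), hs, ofReal_exp_rpow, ofReal_exp_rpow,
      ← ENNReal.ofReal_mul (by positivity), ← ENNReal.ofReal_mul (by positivity),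
      ← ENNReal.ofReal_mul (by positivity), ← ENNReal.ofReal_mul (by positivity),
      ← ENNReal.ofReal_mul (by positivity), ← ENNReal.ofReal_add (by positivity) (by positivity)]
    apply ENNReal.ofReal_le_ofReal
    rw [← Real.exp_add, ← Real.exp_add,
      show r * R + s * (r + 1) = r * (s + R) + s by ring,
      show -(β * R) + s * (1 - β) = -β * (s + R) + s by ring, Real.exp_add, Real.exp_add]
    have h1 := mul_le_mul_of_nonneg_left (Real.add_one_le_exp (r * (s + R))) hβ.le
    have h2 := mul_le_mul_of_nonneg_left (Real.add_one_le_exp (-β * (s + R))) hr.le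
    have h3 : β + r ≤ β * Real.exp (r * (s + R)) + r * Real.exp (-β * (s + R)) := by linarith
    have h4 := mul_le_mul_of_nonneg_right h3 (Real.exp_pos s).le
    linarith
  have hsum := ENNReal.tsum_le_tsum key
  rw [ENNReal.tsum_add, ENNReal.tsum_mul_left, ENNReal.tsum_mul_left, ENNReal.tsum_mul_left,
    ENNReal.tsum_mul_left, ENNReal.tsum_mul_left, hP, mul_one,
    ENNReal.ofReal_add hβ.le hr.le] at hsum
  have h5 : ENNReal.ofReal (Real.exp (-(β * R))) *
      ∑' a, (if 0 < P a then P a ^ (1 - β) else 0) ≤ 1 := by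
    refine (mul_le_mul_right h _).trans ?_
    rw [← ENNReal.ofReal_mul (by positivity), ← Real.exp_add]
    simp
  have h6 := hsum.trans (add_le_add_right (mul_le_of_le_one_right' h5) _)
  have h7 := (ENNReal.add_le_add_iff_right ENNReal.ofReal_ne_top).1 h6
  nth_rw 1 [← mul_one (ENNReal.ofReal β)] at h7
  exact (ENNReal.mul_le_mul_iff_right (by simpa using hβ) ENNReal.ofReal_ne_top).1 h7

lemma one_le_moment_of_order_gt_one {ι : Type*} {P : ι → ℝ≥0∞} (hP : ∑' a, P a = 1)
    {r γ R : ℝ} (hγ : 0 < γ) (hγr : γ < r)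
    (h : ENNReal.ofReal (Real.exp (-(γ * R))) ≤ ∑' a, (if 0 < P a then P a ^ (1 + γ) else 0)) :
    1 ≤ ENNReal.ofReal (Real.exp (r * R)) * ∑' a, P a ^ (r + 1) := by
  have hr : 0 < r := hγ.trans hγr
  have hd : 0 < r - γ := sub_pos.2 hγr
  have key : ∀ a, ENNReal.ofReal r * (ENNReal.ofReal (Real.exp (γ * R)) *
        (if 0 < P a then P a ^ (1 + γ) else 0)) ≤
      ENNReal.ofReal γ * (ENNReal.ofReal (Real.exp (r * R)) * P a ^ (r + 1)) +
      ENNReal.ofReal (r - γ) * P a := by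
    intro a
    rcases eq_or_ne (P a) 0 with h0 | h0
    · simp [h0]
    obtain ⟨s, hs⟩ := exists_eq_ofReal_exp h0 (ne_top_of_tsum_eq_one hP a)
    rw [if_pos (pos_iff_ne_zero.2 h0), hs, ofReal_exp_rpow, ofReal_exp_rpow,
      ← ENNReal.ofReal_mul (by positivity), ← ENNReal.ofReal_mul (by positivity),
      ← ENNReal.ofReal_mul (by positivity), ← ENNReal.ofReal_mul (by positivity),
      ← ENNReal.ofReal_mul (by positivity), ← ENNReal.ofReal_add (by positivity) (by positivity)]
    apply ENNReal.ofReal_le_ofReal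
    rw [← Real.exp_add, ← Real.exp_add,
      show r * R + s * (r + 1) = (γ * (s + R) + (r - γ) * (s + R)) + s by ring,
      show γ * R + s * (1 + γ) = γ * (s + R) + s by ring, Real.exp_add, Real.exp_add,
      Real.exp_add]
    set t := s + R
    have h1 := mul_le_mul_of_nonneg_left (Real.add_one_le_exp ((r - γ) * t))
      (mul_nonneg hγ.le (Real.exp_pos (γ * t)).le)
    have h2 := mul_le_mul_of_nonneg_left (Real.add_one_le_exp (-(γ * t)))
      (mul_nonneg hd.le (Real.exp_pos (γ * t)).le)
    have h2' : Real.exp (γ * t) * Real.exp (-(γ * t)) = 1 := by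
      rw [← Real.exp_add]; simp
    rw [mul_assoc (r - γ) _ (Real.exp _), h2'] at h2
    have h3 : r * Real.exp (γ * t) ≤
        γ * (Real.exp (γ * t) * Real.exp ((r - γ) * t)) + (r - γ) := by
      nlinarith
    have h4 := mul_le_mul_of_nonneg_right h3 (Real.exp_pos s).le
    linarith
  have hsum := ENNReal.tsum_le_tsum key
  rw [ENNReal.tsum_add, ENNReal.tsum_mul_left, ENNReal.tsum_mul_left, ENNReal.tsum_mul_left,
    ENNReal.tsum_mul_left, ENNReal.tsum_mul_left, hP, mul_one] at hsum
  have h5 : 1 ≤ ENNReal.ofReal (Real.exp (γ * R)) *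
      ∑' a, (if 0 < P a then P a ^ (1 + γ) else 0) := by
    refine le_trans ?_ (mul_le_mul_right h _)
    rw [← ENNReal.ofReal_mul (by positivity), ← Real.exp_add]
    simp
  have h6 := (mul_le_mul_right h5 (ENNReal.ofReal r)).trans hsum
  rw [mul_one, show r = γ + (r - γ) by ring, ENNReal.ofReal_add hγ.le hd.le] at h6
  rw [show γ + (r - γ) = r by ring] at h6
  have h7 := (ENNReal.add_le_add_iff_right ENNReal.ofReal_ne_top).1 h6
  nth_rw 1 [← mul_one (ENNReal.ofReal γ)] at h7
  exact (ENNReal.mul_le_mul_iff_right (by simpa using hγ) ENNReal.ofReal_ne_top).1 h7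

lemma one_le_moment_of_shannon {ι : Type*} {P : ι → ℝ≥0∞} (hP : ∑' a, P a = 1)
    {r R : ℝ} (hr : 0 < r) (hR : 0 ≤ R)
    (h : ∑' a, ENNReal.ofReal (-((P a).toReal * Real.log (P a).toReal)) ≤ ENNReal.ofReal R) :
    1 ≤ ENNReal.ofReal (Real.exp (r * R)) * ∑' a, P a ^ (r + 1) := by
  have key : ∀ a, ENNReal.ofReal (1 + r * R) * P a ≤
      ENNReal.ofReal (Real.exp (r * R)) * P a ^ (r + 1) +
      ENNReal.ofReal r * ENNReal.ofReal (-((P a).toReal * Real.log (P a).toReal)) := by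
    intro a
    rcases eq_or_ne (P a) 0 with h0 | h0
    · simp [h0]
    obtain ⟨s, hs⟩ := exists_eq_ofReal_exp h0 (ne_top_of_tsum_eq_one hP a)
    have hs0 : s ≤ 0 := by
      have := (ENNReal.le_tsum a).trans hP.le
      rw [hs] at this
      simpa using this
    rw [hs, ofReal_exp_rpow, ENNReal.toReal_ofReal (by positivity), Real.log_exp,
      ← ENNReal.ofReal_mul (by positivity), ← ENNReal.ofReal_mul (by positivity),
      ← ENNReal.ofReal_mul (by positivity), ← ENNReal.ofReal_add (by positivity)
        (mul_nonneg hr.le (neg_nonneg.2 (mul_nonpos_of_nonneg_of_nonpos (by positivity) hs0)))]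
    apply ENNReal.ofReal_le_ofReal
    rw [← Real.exp_add, show r * R + s * (r + 1) = r * (s + R) + s by ring, Real.exp_add]
    have h4 := mul_le_mul_of_nonneg_right (Real.add_one_le_exp (r * (s + R))) (Real.exp_pos s).le
    linarith
  have hsum := ENNReal.tsum_le_tsum key
  rw [ENNReal.tsum_add, ENNReal.tsum_mul_left, ENNReal.tsum_mul_left, ENNReal.tsum_mul_left,
    hP, mul_one, ENNReal.ofReal_add zero_le_one (by positivity), ENNReal.ofReal_one,
    ENNReal.ofReal_mul hr.le] at hsum
  have h6 := hsum.trans (add_le_add_right (mul_le_mul_right h _) _)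
  exact (ENNReal.add_le_add_iff_right
    (ENNReal.mul_ne_top ENNReal.ofReal_ne_top ENNReal.ofReal_ne_top)).1 h6

lemma one_le_moment_of_min {ι : Type*} {P : ι → ℝ≥0∞} (hP : ∑' a, P a = 1)
    {r R : ℝ} (hr : 0 < r)
    (h : ∀ a, 0 < P a → ENNReal.ofReal (Real.exp (-R)) ≤ P a) :
    1 ≤ ENNReal.ofReal (Real.exp (r * R)) * ∑' a, P a ^ (r + 1) := by
  rw [← ENNReal.tsum_mul_left, ← hP]
  refine ENNReal.tsum_le_tsum fun a => ?_
  rcases eq_or_ne (P a) 0 with h0 | h0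
  · simp [h0]
  have ha := h a (pos_iff_ne_zero.2 h0)
  obtain ⟨s, hs⟩ := exists_eq_ofReal_exp h0 (ne_top_of_tsum_eq_one hP a)
  rw [hs] at ha
  have hs1 : -R ≤ s := Real.exp_le_exp.1 ((ENNReal.ofReal_le_ofReal_iff (by positivity)).1 ha)
  rw [hs, ofReal_exp_rpow, ← ENNReal.ofReal_mul (by positivity), ← Real.exp_add]
  refine ENNReal.ofReal_le_ofReal (Real.exp_le_exp.2 ?_)
  nlinarith

/-- A Rényi entropy bound of order `α < r + 1` forces a lower bound on the `(r + 1)`-st moment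
of the cell probabilities, by monotonicity of the Rényi entropy in its order. -/
lemma one_le_moment_of_renyiEntropy_le {μ : Measure ℝ} {q : ℝ → ℝ}
    (hP : ∑' a, μ (q ⁻¹' {a}) = 1) {r R : ℝ} {α : EReal} (hr : 0 < r) (hR : 0 ≤ R)
    (hα : α < ((r + 1 : ℝ) : EReal)) (h : renyiEntropy α μ q ≤ (R : EReal)) :
    1 ≤ ENNReal.ofReal (Real.exp (r * R)) * ∑' a, μ (q ⁻¹' {a}) ^ (r + 1) := by
  unfold renyiEntropy at h
  rw [if_neg hα.ne_top] at h
  split_ifs at h with h1 h2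
  · rw [EReal.neg_le, ← EReal.coe_neg, coe_le_log_iff] at h
    exact one_le_moment_of_min hP hr fun a ha => h.trans (iInf₂_le a ha)
  · refine one_le_moment_of_shannon hP hr hR ?_
    rw [← EReal.coe_ennreal_le_coe_ennreal_iff]
    refine h.trans ?_
    rw [EReal.coe_ennreal_ofReal, max_eq_left hR]
  · lift α to ℝ using ⟨hα.ne_top, h1⟩
    rw [EReal.toReal_coe] at h
    have hα' : α < r + 1 := EReal.coe_lt_coe_iff.1 hα
    have h2' : α ≠ 1 := fun h => h2 (by rw [h]; rfl)
    rcases lt_or_gt_of_ne h2' with hlt | hgt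
    · have hβ : 0 < 1 - α := sub_pos.2 hlt
      refine one_le_moment_of_order_lt_one hP hr hβ ?_
      rw [← log_le_coe_iff, sub_sub_cancel]
      have := mul_le_mul_of_nonneg_left h (EReal.coe_nonneg.2 hβ.le)
      rwa [← mul_assoc, ← EReal.coe_mul, ← EReal.coe_mul, mul_inv_cancel₀ hβ.ne', EReal.coe_one,
        one_mul] at this
    · have hγ : 0 < α - 1 := sub_pos.2 hgt
      refine one_le_moment_of_order_gt_one hP hγ (by linarith) ?_
      rw [← coe_le_log_iff, add_sub_cancel]
      rw [← neg_sub α 1, inv_neg, EReal.coe_neg, EReal.neg_mul, EReal.neg_le,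
        ← EReal.coe_neg] at h
      have := mul_le_mul_of_nonneg_left h (EReal.coe_nonneg.2 hγ.le)
      rwa [← mul_assoc, ← EReal.coe_mul, ← EReal.coe_mul, mul_inv_cancel₀ hγ.ne', EReal.coe_one,
        one_mul, mul_neg] at this

/-- A quantizer all of whose nontrivial cells have probability `1 / N` has Rényi entropy at most
`log N`, for every order `α < ∞`. -/
lemma renyiEntropy_le_of_uniform {μ : Measure ℝ} {q : ℝ → ℝ}
    (hP : ∑' a, μ (q ⁻¹' {a}) = 1) {L : ℝ} {α : EReal} (hα : α ≠ ⊤) (hL : 0 ≤ L)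
    (h : ∀ a, μ (q ⁻¹' {a}) ≠ 0 → μ (q ⁻¹' {a}) = ENNReal.ofReal (Real.exp (-L))) :
    renyiEntropy α μ q ≤ (L : EReal) := by
  unfold renyiEntropy
  rw [if_neg hα]
  split_ifs with h1 h2
  · rw [EReal.neg_le, ← EReal.coe_neg, coe_le_log_iff]
    exact le_iInf₂ fun a ha => (h a (pos_iff_ne_zero.1 ha)).ge
  · have : ∀ a, ENNReal.ofReal (-((μ (q ⁻¹' {a})).toReal * Real.log (μ (q ⁻¹' {a})).toReal)) =
        ENNReal.ofReal L * μ (q ⁻¹' {a}) := by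
      intro a
      rcases eq_or_ne (μ (q ⁻¹' {a})) 0 with h0 | h0
      · simp [h0]
      rw [h a h0, ENNReal.toReal_ofReal (by positivity), Real.log_exp, ← ENNReal.ofReal_mul hL]
      congr 1
      ring
    simp_rw [this]
    rw [ENNReal.tsum_mul_left, hP, mul_one, EReal.coe_ennreal_ofReal, max_eq_left hL]
  · lift α to ℝ using ⟨hα, h1⟩
    rw [EReal.toReal_coe]
    have h2' : 1 - α ≠ 0 := fun h => h2 (by rw [← sub_eq_zero.1 h]; rfl)
    have : ∀ a, (if 0 < μ (q ⁻¹' {a}) then μ (q ⁻¹' {a}) ^ α else 0) =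
        ENNReal.ofReal (Real.exp ((1 - α) * L)) * μ (q ⁻¹' {a}) := by
      intro a
      rcases eq_or_ne (μ (q ⁻¹' {a})) 0 with h0 | h0
      · simp [h0]
      rw [if_pos (pos_iff_ne_zero.2 h0), h a h0, ofReal_exp_rpow,
        ← ENNReal.ofReal_mul (by positivity), ← Real.exp_add]
      congr 2
      ring
    simp_rw [this]
    rw [ENNReal.tsum_mul_left, hP, mul_one, ENNReal.log_ofReal_of_pos (Real.exp_pos _),
      Real.log_exp, ← EReal.coe_mul, inv_mul_cancel_left₀ h2']

lemma tsum_setLIntegral_fiber {μ : Measure ℝ} {q : ℝ → ℝ} (hq : IsQuantizer q) (f : ℝ → ℝ≥0∞) :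
    ∑' a, ∫⁻ x in q ⁻¹' {a}, f x ∂μ = ∫⁻ x, f x ∂μ := by
  have hsupp : (Function.support fun a => ∫⁻ x in q ⁻¹' {a}, f x ∂μ) ⊆ range q := by
    intro a ha
    by_contra hn
    apply ha
    simp [preimage_singleton_eq_empty.2 hn]
  rw [← tsum_subtype_eq_of_support_subset hsupp,
    ← lintegral_biUnion hq.2 (fun a _ => hq.1 (measurableSet_singleton a))
      ((pairwise_disjoint_fiber q).set_pairwise _)]
  simp [← preimage_iUnion]

lemma distortion_eq_tsum {μ : Measure ℝ} {q : ℝ → ℝ} (hq : IsQuantizer q) (r : ℝ) :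
    distortion r μ q = ∑' a, ∫⁻ x in q ⁻¹' {a}, ENNReal.ofReal (|x - a| ^ r) ∂μ := by
  rw [distortion, ← tsum_setLIntegral_fiber hq]
  refine tsum_congr fun a => setLIntegral_congr_fun (hq.1 (measurableSet_singleton a)) ?_
  intro x hx
  have : q x = a := hx
  simp only [this]

lemma tsum_measure_fiber {μ : Measure ℝ} [IsProbabilityMeasure μ] {q : ℝ → ℝ}
    (hq : IsQuantizer q) : ∑' a, μ (q ⁻¹' {a}) = 1 := by
  have := tsum_setLIntegral_fiber (μ := μ) hq 1
  simpa using this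

lemma setLIntegral_Ico_abs_sub_rpow {r : ℝ} (hr : 0 < r) (a : ℝ) {h : ℝ} (hh : 0 ≤ h) :
    ∫⁻ x in Ico (a - h) (a + h), ENNReal.ofReal (|x - a| ^ r) =
      ENNReal.ofReal (Cr r * (2 * h) ^ (r + 1)) := by
  have hcont : Continuous fun x : ℝ => |x - a| ^ r :=
    (continuous_abs.comp (continuous_id.sub continuous_const)).rpow_const fun _ => Or.inr hr.le
  have hint : ∫ x in (a - h)..(a + h), |x - a| ^ r = Cr r * (2 * h) ^ (r + 1) := by
    have hc2 : Continuous fun x : ℝ => |x| ^ r :=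
      continuous_abs.rpow_const fun _ => Or.inr hr.le
    rw [intervalIntegral.integral_comp_sub_right (fun x => |x| ^ r) a,
      ← intervalIntegral.integral_add_adjacent_intervals (b := 0)
        (hc2.intervalIntegrable _ _) (hc2.intervalIntegrable _ _)]
    have h1 : ∫ x in (0:ℝ)..h, |x| ^ r = h ^ (r + 1) / (r + 1) := by
      rw [intervalIntegral.integral_congr (g := fun x => x ^ r), integral_rpow (Or.inl (by linarith)),
        Real.zero_rpow (by linarith), sub_zero]
      intro x hx
      rw [uIcc_of_le hh] at hx
      simp only [abs_of_nonneg hx.1]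
    have h2 : ∫ x in (-h)..0, |x| ^ r = ∫ x in (0:ℝ)..h, |x| ^ r := by
      have := intervalIntegral.integral_comp_neg (a := 0) (b := h) (fun x : ℝ => |x| ^ r)
      simpa using this.symm
    rw [show a - h - a = -h by ring, show a + h - a = h by ring, h2, h1, Cr,
      Real.mul_rpow (by norm_num) hh, Real.rpow_add (by norm_num : (0:ℝ) < 2), Real.rpow_one]
    have : (0:ℝ) < 2 ^ r := by positivity
    field_simp
    ring
  rw [← hint, intervalIntegral.integral_of_le (by linarith), ofReal_integral_eq_lintegral_ofReal
    ((hcont.intervalIntegrable (a - h) (a + h)).1) (ae_of_all _ fun x => by positivity)]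
  exact (setLIntegral_congr Ico_ae_eq_Ioc)

/-- Among sets of given Lebesgue measure, the interval centred at `a` minimizes the `r`-th moment
about `a`. -/
lemma le_setLIntegral_abs_sub_rpow {r : ℝ} (hr : 0 < r) (a : ℝ) {A : Set ℝ}
    (hA : MeasurableSet A) (hfin : volume A ≠ ⊤) :
    ENNReal.ofReal (Cr r) * volume A ^ (r + 1) ≤ ∫⁻ x in A, ENNReal.ofReal (|x - a| ^ r) := by
  set h := (volume A).toReal / 2 with hh
  have hh0 : 0 ≤ h := by positivity
  set B := Ico (a - h) (a + h) with hB
  have hBm : MeasurableSet B := measurableSet_Ico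
  have hvB : volume B = volume A := by
    rw [hB, Real.volume_Ico, show a + h - (a - h) = (volume A).toReal by rw [hh]; ring,
      ENNReal.ofReal_toReal hfin]
  have hCr : 0 ≤ Cr r := by unfold Cr; positivity
  have hlhs : ENNReal.ofReal (Cr r) * volume A ^ (r + 1) =
      ∫⁻ x in B, ENNReal.ofReal (|x - a| ^ r) := by
    rw [setLIntegral_Ico_abs_sub_rpow hr a hh0, ENNReal.ofReal_mul hCr,
      ← ENNReal.ofReal_rpow_of_nonneg (by positivity) (by positivity),
      show 2 * h = (volume A).toReal by rw [hh]; ring, ENNReal.ofReal_toReal hfin]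
  have hdiff : volume (A \ B) = volume (B \ A) := by
    have h1 := measure_sdiff_add_inter (μ := volume) A hBm
    have h2 := measure_sdiff_add_inter (μ := volume) B hA
    rw [hvB, ← h1, inter_comm] at h2
    exact ((ENNReal.add_left_inj (measure_ne_top_of_subset inter_subset_left hfin)).1 h2).symm
  rw [hlhs, ← lintegral_inter_add_sdiff (μ := volume) _ B hA,
    ← lintegral_inter_add_sdiff (μ := volume) _ A hBm, inter_comm B A]
  refine add_le_add_right ?_ _
  calc ∫⁻ x in B \ A, ENNReal.ofReal (|x - a| ^ r)
      ≤ ∫⁻ _ in B \ A, ENNReal.ofReal (h ^ r) := by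
        refine setLIntegral_mono' (hBm.diff hA) fun x hx => ENNReal.ofReal_le_ofReal ?_
        refine Real.rpow_le_rpow (abs_nonneg _) (abs_le.2 ⟨?_, ?_⟩) hr.le
        · linarith [hx.1.1]
        · linarith [hx.1.2]
    _ = ∫⁻ _ in A \ B, ENNReal.ofReal (h ^ r) := by simp [hdiff]
    _ ≤ ∫⁻ x in A \ B, ENNReal.ofReal (|x - a| ^ r) := by
        refine setLIntegral_mono' (hA.diff hBm) fun x hx => ENNReal.ofReal_le_ofReal ?_
        refine Real.rpow_le_rpow hh0 ?_ hr.le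
        by_contra hlt
        rw [not_le, abs_lt] at hlt
        exact hx.2 ⟨by linarith, by linarith⟩

lemma Cr_mul_moment_le_distortion {q : ℝ → ℝ} (hq : IsQuantizer q) {r : ℝ} (hr : 0 < r) :
    ENNReal.ofReal (Cr r) * ∑' a, volume.restrict (Icc (0 : ℝ) 1) (q ⁻¹' {a}) ^ (r + 1) ≤
      distortion r (volume.restrict (Icc (0 : ℝ) 1)) q := by
  rw [distortion_eq_tsum hq, ← ENNReal.tsum_mul_left]
  refine ENNReal.tsum_le_tsum fun a => ?_
  have hm : MeasurableSet (q ⁻¹' {a}) := hq.1 (measurableSet_singleton a)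
  rw [Measure.restrict_apply hm, Measure.restrict_restrict hm]
  exact le_setLIntegral_abs_sub_rpow hr a (hm.inter measurableSet_Icc)
    (measure_ne_top_of_subset inter_subset_right (by simp))

/-- The midpoint quantizer with cells `[i / N, (i + 1) / N)`. -/
def floorQ (N : ℕ) (x : ℝ) : ℝ := ((⌊x * N⌋ : ℤ) + 1 / 2 : ℝ) / N

lemma isQuantizer_floorQ (N : ℕ) : IsQuantizer (floorQ N) := by
  constructor
  · unfold floorQ
    fun_prop
  · have : range (floorQ N) ⊆ range fun i : ℤ => ((i : ℝ) + 1 / 2) / N := by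
      rintro _ ⟨x, rfl⟩
      exact ⟨⌊x * N⌋, rfl⟩
    exact (countable_range _).mono this

lemma floorQ_fiber {N : ℕ} (hN : 0 < N) (y : ℝ) :
    floorQ N ⁻¹' {floorQ N y} =
      Ico ((⌊y * N⌋ : ℝ) / N) (((⌊y * N⌋ : ℝ) + 1) / N) := by
  have hN' : (0 : ℝ) < N := by exact_mod_cast hN
  ext x
  rw [mem_preimage, mem_singleton_iff, floorQ, floorQ, div_left_inj' hN'.ne', add_left_inj,
    Int.cast_inj, Int.floor_eq_iff, mem_Ico, div_le_iff₀ hN', lt_div_iff₀ hN']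

lemma floorQ_fiber_eq_Ico {N : ℕ} (hN : 0 < N) {a : ℝ} (ha : a ∈ range (floorQ N)) :
    floorQ N ⁻¹' {a} = Ico (a - 1 / (2 * N)) (a + 1 / (2 * N)) := by
  obtain ⟨y, rfl⟩ := ha
  have hN' : (0 : ℝ) < N := by exact_mod_cast hN
  rw [floorQ_fiber hN, floorQ]
  congr 1 <;> field_simp <;> ring

lemma restrict_floorQ_fiber {N : ℕ} (hN : 0 < N) {a : ℝ}
    (h0 : volume.restrict (Icc (0 : ℝ) 1) (floorQ N ⁻¹' {a}) ≠ 0) :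
    volume.restrict (Icc (0 : ℝ) 1) (floorQ N ⁻¹' {a}) = ENNReal.ofReal (1 / N) := by
  have hN' : (0 : ℝ) < N := by exact_mod_cast hN
  have ha : a ∈ range (floorQ N) := by
    by_contra hn
    apply h0
    simp [preimage_singleton_eq_empty.2 hn]
  obtain ⟨y, rfl⟩ := ha
  rw [floorQ_fiber hN, Measure.restrict_apply measurableSet_Ico] at h0 ⊢
  set i := ⌊y * N⌋
  have hi0 : 0 ≤ i := by
    by_contra hneg
    have h1 : (i : ℝ) + 1 ≤ 0 := by exact_mod_cast not_le.1 hneg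
    apply h0
    rw [(_ : Ico ((i : ℝ) / N) (((i : ℝ) + 1) / N) ∩ Icc 0 1 = ∅), measure_empty]
    ext x
    simp only [mem_inter_iff, mem_Ico, mem_Icc, mem_empty_iff_false, iff_false]
    rintro ⟨⟨-, h2⟩, h3, -⟩
    have := div_nonpos_of_nonpos_of_nonneg h1 hN'.le
    linarith
  have hi1 : i < N := by
    by_contra hge
    have h1 : (N : ℝ) ≤ i := by exact_mod_cast not_lt.1 hge
    apply h0
    refine measure_mono_null (t := {1}) ?_ (by simp)
    rintro x ⟨⟨h2, -⟩, -, h3⟩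
    have := (one_le_div hN').2 h1
    exact le_antisymm h3 (this.trans h2)
  have h1 : (i : ℝ) + 1 ≤ N := by exact_mod_cast hi1
  have h2 : (0 : ℝ) ≤ i := by exact_mod_cast hi0
  rw [inter_eq_left.2, Real.volume_Ico]
  · congr 1
    ring
  · intro x hx
    exact ⟨(div_nonneg h2 hN'.le).trans hx.1, hx.2.le.trans ((div_le_one hN').2 h1)⟩

lemma distortion_floorQ_le {N : ℕ} (hN : 0 < N) {r : ℝ} (hr : 0 < r) :
    distortion r (volume.restrict (Icc (0 : ℝ) 1)) (floorQ N) ≤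
      ENNReal.ofReal (Cr r * (1 / N) ^ r) := by
  have hN' : (0 : ℝ) < N := by exact_mod_cast hN
  have hCr : 0 ≤ Cr r := by unfold Cr; positivity
  have : IsProbabilityMeasure (volume.restrict (Icc (0 : ℝ) 1)) := ⟨by simp⟩
  rw [distortion_eq_tsum (isQuantizer_floorQ N), ← mul_one (ENNReal.ofReal _),
    ← tsum_measure_fiber (μ := volume.restrict (Icc (0 : ℝ) 1)) (isQuantizer_floorQ N),
    ← ENNReal.tsum_mul_left]
  refine ENNReal.tsum_le_tsum fun a => ?_
  rcases eq_or_ne (volume.restrict (Icc (0 : ℝ) 1) (floorQ N ⁻¹' {a})) 0 with h0 | h0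
  · rw [setLIntegral_measure_zero _ _ h0]
    exact zero_le
  have ha : a ∈ range (floorQ N) := by
    by_contra hn
    apply h0
    simp [preimage_singleton_eq_empty.2 hn]
  rw [restrict_floorQ_fiber hN h0, ← ENNReal.ofReal_mul (by positivity), mul_assoc,
    ← Real.rpow_add_one (by positivity), floorQ_fiber_eq_Ico hN ha]
  refine (lintegral_mono' (Measure.restrict_mono' Filter.EventuallyLE.rfl
    Measure.restrict_le_self) le_rfl).trans ?_
  rw [setLIntegral_Ico_abs_sub_rpow hr a (by positivity)]
  apply le_of_eq
  congr 3
  field_simp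

lemma le_optErr_uniform {r R : ℝ} {α : EReal} (hr : 0 < r) (hR : 0 ≤ R)
    (hα : α < ((r + 1 : ℝ) : EReal)) :
    ENNReal.ofReal (Cr r) ≤ ENNReal.ofReal (Real.exp (r * R)) *
      optErr r α (volume.restrict (Icc (0 : ℝ) 1)) R := by
  have : IsProbabilityMeasure (volume.restrict (Icc (0 : ℝ) 1)) := ⟨by simp⟩
  unfold optErr
  simp_rw [ENNReal.mul_iInf_of_ne (ENNReal.ofReal_pos.2 (Real.exp_pos _)).ne' ENNReal.ofReal_ne_top]
  refine le_iInf₂ fun q hq => ?_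
  have h1 := one_le_moment_of_renyiEntropy_le (tsum_measure_fiber hq.1) hr hR hα hq.2
  calc ENNReal.ofReal (Cr r) ≤ ENNReal.ofReal (Cr r) * _ := le_mul_of_one_le_right' h1
    _ = ENNReal.ofReal (Real.exp (r * R)) * (ENNReal.ofReal (Cr r) * _) := by
        rw [mul_left_comm]
    _ ≤ _ := mul_le_mul_right (Cr_mul_moment_le_distortion hq.1 hr) _

lemma optErr_uniform_le {r R : ℝ} {α : EReal} (hr : 0 < r) (hR : 0 ≤ R) (hα : α ≠ ⊤) :
    optErr r α (volume.restrict (Icc (0 : ℝ) 1)) R ≤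
      ENNReal.ofReal (Cr r * (1 / (⌊Real.exp R⌋₊ : ℝ)) ^ r) := by
  have : IsProbabilityMeasure (volume.restrict (Icc (0 : ℝ) 1)) := ⟨by simp⟩
  have hN : 0 < ⌊Real.exp R⌋₊ := Nat.floor_pos.2 (Real.one_le_exp hR)
  have hN1 : (1 : ℝ) ≤ ⌊Real.exp R⌋₊ := by exact_mod_cast hN
  have hlog : Real.log ⌊Real.exp R⌋₊ ≤ R := by
    rw [Real.log_le_iff_le_exp (by positivity)]
    exact Nat.floor_le (Real.exp_pos R).le
  refine (iInf₂_le (floorQ ⌊Real.exp R⌋₊) ⟨isQuantizer_floorQ _, ?_⟩).trans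
    (distortion_floorQ_le hN hr)
  refine (renyiEntropy_le_of_uniform (tsum_measure_fiber (isQuantizer_floorQ _)) hα
    (Real.log_nonneg hN1) fun a ha => ?_).trans (EReal.coe_le_coe_iff.2 hlog)
  rw [restrict_floorQ_fiber hN ha, Real.exp_neg, Real.exp_log (by positivity), one_div]

/-- sharp high-rate asymptotics for the uniform distribution on `[0,1]`. -/
theorem statement19
    (r : ℝ) (hr : 1 < r) (α : EReal) (hα : α < ((r + 1 : ℝ) : EReal)) :
    Tendsto
      (fun R : ℝ => ENNReal.ofReal (Real.exp (r * R)) *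
        optErr r α ((volume (Set.Icc (0 : ℝ) 1))⁻¹ • volume.restrict (Set.Icc (0 : ℝ) 1)) R)
      atTop (𝓝 (ENNReal.ofReal (Cr r))) := by
  have hr0 : 0 < r := by linarith
  have hμ : (volume (Set.Icc (0 : ℝ) 1))⁻¹ • volume.restrict (Set.Icc (0 : ℝ) 1) =
      volume.restrict (Set.Icc (0 : ℝ) 1) := by simp
  rw [hμ]
  have hlim : Tendsto (fun R : ℝ => ENNReal.ofReal
      (Cr r * (((⌊Real.exp R⌋₊ : ℝ) / Real.exp R)⁻¹) ^ r)) atTop (𝓝 (ENNReal.ofReal (Cr r))) := by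
    have h1 := (tendsto_nat_floor_div_atTop (R := ℝ)).comp Real.tendsto_exp_atTop
    have h2 := ((h1.inv₀ one_ne_zero).rpow_const (p := r) (Or.inr hr0.le)).const_mul (Cr r)
    rw [inv_one, Real.one_rpow, mul_one] at h2
    exact ENNReal.tendsto_ofReal h2
  refine tendsto_of_tendsto_of_tendsto_of_le_of_le' tendsto_const_nhds hlim ?_ ?_
  · filter_upwards [eventually_ge_atTop 0] with R hR
    exact le_optErr_uniform hr0 hR hα
  · filter_upwards [eventually_ge_atTop 0] with R hR
    refine (mul_le_mul_right (optErr_uniform_le hr0 hR hα.ne_top) _).trans (le_of_eq ?_)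
    rw [← ENNReal.ofReal_mul (Real.exp_pos _).le, mul_comm r R, Real.exp_mul, mul_left_comm,
      ← Real.mul_rpow (Real.exp_pos _).le (by positivity), inv_div, mul_one_div]

end
end
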